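/- For every 0 ≤ k ≤ n−1, every ℓ ∈ {1,…,d} and every j_ℓ ∈ {1,…,N_{k+1}^ℓ}, assuming |σ_k^{ℓ•}(x_k^i)|_2 > 0 for all i ∈ I_k with P(X̂_k = x_k^i) > 0, the (unconditional) companion weight of the ℓ-th marginal satisfies P( X̃_{k+1}^ℓ ∈ C_{j_ℓ}(Γ_{k+1}^ℓ) ) = Σ_{i ∈ I_k} [ Φ_0( (x_{k+1}^{ℓ,j_ℓ+1/2} − m_k^ℓ(x_k^i)) / (√Δ |σ_k^{ℓ•}(x_k^i)|_2) ) − Φ_0( (x_{k+1}^{ℓ,j_ℓ−1/2} − m_k^ℓ(x_k^i)) / (√Δ |σ_k^{ℓ•}(x_k^i)|_2) ) ] · P(X̂_k = x_k^i). -/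

import Mathlib

open MeasureTheory ProbabilityTheory Real Set
open scoped ENNReal NNReal Classical

noncomputable section

namespace MPQ

/-- Standard normal cumulative distribution function `Φ₀`. -/
def Phi0 (x : ℝ) : ℝ := ((gaussianReal 0 1) (Set.Iic x)).toReal

/-- `Φ₀` extended to `EReal`, with `Φ₀(−∞) = 0` and `Φ₀(+∞) = 1`. -/
def Phi0E (x : EReal) : ℝ := if x = ⊥ then 0 else if x = ⊤ then 1 else Phi0 x.toReal

/-- Standard normal density `Φ₀'` extended to `EReal`, vanishing at `±∞`. -/
def phi0E (x : EReal) : ℝ := if x = ⊥ ∨ x = ⊤ then 0 else gaussianPDFReal 0 1 x.toReal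

/-- `a ↦ a·Φ₀'(a)` extended to `EReal`, with the convention that it vanishes at `±∞`. -/
def idphi0E (x : EReal) : ℝ :=
  if x = ⊥ ∨ x = ⊤ then 0 else x.toReal * gaussianPDFReal 0 1 x.toReal

/-- The affine renormalisation `c ↦ (c − m)/v` on `EReal` (taking the sign of `v` into
account at `±∞`). -/
def affE (c : EReal) (m v : ℝ) : EReal :=
  if c = ⊤ then (if v < 0 then ⊥ else ⊤)
  else if c = ⊥ then (if v < 0 then ⊤ else ⊥)
  else (((c.toReal - m) / v : ℝ) : EReal)

/-- Lower half-point `x^{j−1/2}` of the `j`-th Voronoi cell (0-based indexing) of the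
grid `g`, with `x^{-1/2} = −∞`. -/
def lo (g : ℕ → ℝ) (j : ℕ) : EReal :=
  if j = 0 then ⊥ else (((g (j - 1) + g j) / 2 : ℝ) : EReal)

/-- Upper half-point `x^{j+1/2}` of the `j`-th Voronoi cell (0-based indexing) of a grid
`g` of size `m`, with the last one equal to `+∞`. -/
def hi (m : ℕ) (g : ℕ → ℝ) (j : ℕ) : EReal :=
  if j + 1 = m then ⊤ else (((g j + g (j + 1)) / 2 : ℝ) : EReal)

/-- The `j`-th Voronoi cell of a (sorted) grid `g` of size `m`. -/
def cell (m : ℕ) (g : ℕ → ℝ) (j : ℕ) : Set ℝ :=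
  {y : ℝ | lo g j < (y : EReal) ∧ (y : EReal) < hi m g j}

/-- Distance from `ξ` to a grid `g` of size `m`. -/
def distToGrid (m : ℕ) (g : ℕ → ℝ) (ξ : ℝ) : ℝ :=
  sInf ((fun j => |ξ - g j|) '' {j | j < m})

/-- Euclidean norm on `Fin d → ℝ`. -/
def enorm2 {d : ℕ} (x : Fin d → ℝ) : ℝ := Real.sqrt (∑ ℓ, (x ℓ) ^ 2)

/-- Frobenius norm of a `d × q` matrix. -/
def fnorm {d q : ℕ} (a : Fin d → Fin q → ℝ) : ℝ := Real.sqrt (∑ ℓ, ∑ p, (a ℓ p) ^ 2)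

/-- The standard Gaussian distribution `N(0; I_m)` on `ℝ^m`. -/
def gaussPi (m : ℕ) : Measure (Fin m → ℝ) := Measure.pi fun _ => gaussianReal 0 1

/-- The probability of an event, as a real number. -/
def pr {Ω : Type*} [MeasureSpace Ω] (A : Set Ω) : ℝ := (ℙ A).toReal

/-- The conditional probability `P(A | B) = P(A ∩ B)/P(B)`. -/
def condPr {Ω : Type*} [MeasureSpace Ω] (A B : Set Ω) : ℝ := pr (A ∩ B) / pr B

end MPQ

open MPQ

namespace MPQ

/-- A linear combination of the coordinates of `N(0; I_q)`, divided by the Euclidean norm of its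
coefficients, is standard normal. -/
lemma map_normalized_sum_gaussPi {q : ℕ} (c : Fin q → ℝ) (hc : 0 < √(∑ p, c p ^ 2)) :
    (gaussPi q).map (fun z => (∑ p, c p * z p) / √(∑ p, c p ^ 2)) = gaussianReal 0 1 := by
  set s := √(∑ p, c p ^ 2)
  have hs2 : s ^ 2 = ∑ p, c p ^ 2 := Real.sq_sqrt (Finset.sum_nonneg fun p _ => sq_nonneg _)
  have hscale : (gaussPi q).map (fun z p => c p / s * z p) =
      Measure.pi fun p => (gaussianReal 0 1).map (c p / s * ·) := by
    have : ∀ p, IsProbabilityMeasure ((gaussianReal 0 1).map (c p / s * ·)) := fun p =>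
      Measure.isProbabilityMeasure_map (by fun_prop)
    exact Measure.pi_map_pi (fun p => by fun_prop)
  have hsum : (fun z : Fin q → ℝ => (∑ p, c p * z p) / s) =
      (fun x : Fin q → ℝ => ∑ p, x p) ∘ fun z p => c p / s * z p := by
    ext z
    simp only [Function.comp_apply, Finset.sum_div]
    exact Finset.sum_congr rfl fun p _ => by ring
  rw [hsum, ← Measure.map_map (by fun_prop) (by fun_prop), hscale]
  simp_rw [gaussianReal_map_const_mul]
  refine Measure.ext_of_charFun ?_
  ext t
  rw [charFun_map_sum_pi_eq_prod]
  simp only [Finset.prod_apply, charFun_gaussianReal, ← Complex.exp_sum]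
  congr 1
  have hone : ∑ p, (c p / s) ^ 2 = 1 := by
    simp_rw [div_pow]
    rw [← Finset.sum_div, hs2, div_self (hs2 ▸ (pow_pos hc 2).ne')]
  have honeC : ∑ p, ((c p : ℂ) / s) ^ 2 = 1 := by exact_mod_cast hone
  simp only [mul_zero, Complex.ofReal_zero, zero_mul, zero_sub, mul_one, NNReal.coe_mk,
    Complex.ofReal_pow, Complex.ofReal_div, Finset.sum_neg_distrib, NNReal.coe_one,
    Complex.ofReal_one, one_mul]
  rw [← Finset.sum_div, ← Finset.sum_mul, honeC, one_mul]

lemma gaussianReal_affine_le {v : ℝ} (hv : 0 < v) (m : ℝ) (c : EReal) :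
    (gaussianReal 0 1).real {y | ((m + v * y : ℝ) : EReal) ≤ c} = Phi0E (affE c m v) := by
  induction c with
  | bot => simp [affE, Phi0E, hv.not_gt, -EReal.coe_add]
  | top => simp [affE, Phi0E, hv.not_gt, -EReal.coe_add]
  | coe c =>
    have : {y : ℝ | m + v * y ≤ c} = Iic ((c - m) / v) := by
      ext y
      rw [mem_ofPred_eq, mem_Iic, le_div_iff₀ hv, mul_comm y, le_sub_iff_add_le']
    simp [affE, Phi0E, Phi0, this, Measure.real, -EReal.coe_add]

lemma gaussianReal_affine_lt {v : ℝ} (hv : 0 < v) (m : ℝ) (c : EReal) :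
    (gaussianReal 0 1).real {y | ((m + v * y : ℝ) : EReal) < c} = Phi0E (affE c m v) := by
  have := nullSingletonClass_gaussianReal (μ := 0) (v := 1) one_ne_zero
  rw [← gaussianReal_affine_le hv, measureReal_congr]
  refine Filter.EventuallyLE.antisymm (.of_forall fun y hy => le_of_lt hy) ?_
  have hne : ∀ᵐ y ∂gaussianReal 0 1, y ≠ (c.toReal - m) / v := by
    simp [ae_iff]
  filter_upwards [hne] with y hy hle
  refine lt_of_le_of_ne hle fun h => hy ?_
  rw [← h, EReal.toReal_coe]
  field_simp
  ring

lemma lo_lt_hi {N : ℕ} {g : ℕ → ℝ} (hg : StrictMonoOn g {j | j < N}) {j : ℕ} (hj : j < N) :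
    lo g j < hi N g j := by
  unfold lo hi
  split_ifs with h0 h1 h1
  · exact bot_lt_top
  · exact EReal.bot_lt_coe _
  · exact EReal.coe_lt_top _
  · rw [EReal.coe_lt_coe_iff]
    have h₁ := hg (show j - 1 < N by omega) hj (show j - 1 < j by omega)
    have h₂ := hg hj (show j + 1 < N by omega) (Nat.lt_succ_self j)
    linarith

lemma measurableSet_cell (N : ℕ) (g : ℕ → ℝ) (j : ℕ) : MeasurableSet (cell N g j) :=
  (measurableSet_lt measurable_const measurable_coe_real_ereal).inter
    (measurableSet_lt measurable_coe_real_ereal measurable_const)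

lemma gaussianReal_affine_cell {N : ℕ} {g : ℕ → ℝ} (hg : StrictMonoOn g {j | j < N}) {j : ℕ}
    (hj : j < N) {v : ℝ} (hv : 0 < v) (m : ℝ) :
    (gaussianReal 0 1).real {y | m + v * y ∈ cell N g j} =
      Phi0E (affE (hi N g j) m v) - Phi0E (affE (lo g j) m v) := by
  rw [← gaussianReal_affine_lt hv, ← gaussianReal_affine_le hv, ← measureReal_sdiff]
  · congr 1
    ext y
    simp only [cell, mem_ofPred_eq, mem_sdiff, not_le]
    exact and_comm
  · exact fun y hy => lt_of_le_of_lt hy (lo_lt_hi hg hj)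
  · exact measurableSet_le (measurable_coe_real_ereal.comp (by fun_prop)) measurable_const

/-- The probability that an Euler step from a fixed point falls into a Voronoi cell. -/
lemma gaussPi_affine_cell {q N : ℕ} {g : ℕ → ℝ} (hg : StrictMonoOn g {j | j < N}) {j : ℕ}
    (hj : j < N) {r : ℝ} (hr : 0 < r) (m : ℝ) (c : Fin q → ℝ) (hc : 0 < √(∑ p, c p ^ 2)) :
    (gaussPi q).real {z | m + r * ∑ p, c p * z p ∈ cell N g j} =
      Phi0E (affE (hi N g j) m (r * √(∑ p, c p ^ 2))) -
        Phi0E (affE (lo g j) m (r * √(∑ p, c p ^ 2))) := by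
  have hmeas : MeasurableSet {y : ℝ | m + r * √(∑ p, c p ^ 2) * y ∈ cell N g j} :=
    (measurableSet_cell N g j).preimage (by fun_prop)
  rw [← gaussianReal_affine_cell hg hj (mul_pos hr hc), ← map_normalized_sum_gaussPi c hc,
    map_measureReal_apply (by fun_prop) hmeas]
  congr 1
  ext z
  rw [mem_preimage, mem_ofPred_eq, mem_ofPred_eq, mul_assoc, mul_div_cancel₀ _ hc.ne']

end MPQ


/-- Companion weight of the `ℓ`-th marginal of the Markovian product
quantization: `P(X̃_{k+1}^ℓ ∈ C_{j_ℓ}(Γ_{k+1}^ℓ))` is the weighted sum over `i ∈ I_k` of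
the Gaussian cdf differences at the renormalised half-points, weighted by
`P(X̂_k = x_k^i)`. -/
theorem statement_2
    {Ω : Type*} [MeasureSpace Ω] [IsProbabilityMeasure (ℙ : Measure Ω)]
    (d q n : ℕ) (hd : 0 < d) (hq : 0 < q) (hn : 0 < n)
    (T Δ : ℝ) (hT : 0 < T) (hΔ : Δ = T / n)
    (b : ℕ → (Fin d → ℝ) → Fin d → ℝ)
    (σm : ℕ → (Fin d → ℝ) → Fin d → Fin q → ℝ)
    (N : ℕ → Fin d → ℕ) (hN : ∀ k ℓ, 0 < N k ℓ)
    (grid : ℕ → Fin d → ℕ → ℝ)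
    (hgrid : ∀ k ℓ, StrictMonoOn (grid k ℓ) {j | j < N k ℓ})
    (Z : ℕ → Ω → Fin q → ℝ) (hZmeas : ∀ k, Measurable (Z k))
    (hZlaw : ∀ k, Measure.map (Z (k + 1)) ℙ = gaussPi q)
    (Xtil Xhat : ℕ → Ω → Fin d → ℝ)
    (hXtilmeas : ∀ k, Measurable (Xtil k)) (hXhatmeas : ∀ k, Measurable (Xhat k))
    (hindep : ∀ k, IndepFun (Xhat k) (Z (k + 1)) ℙ)
    (hX0 : Xtil 0 = Xhat 0)
    (hrec : ∀ k ω ℓ, Xtil (k + 1) ω ℓ =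
      Xhat k ω ℓ + Δ * b k (Xhat k ω) ℓ +
        Real.sqrt Δ * ∑ p, σm k (Xhat k ω) ℓ p * Z (k + 1) ω p)
    (hproj : ∀ k ω ℓ j, j < N k ℓ →
      Xtil k ω ℓ ∈ cell (N k ℓ) (grid k ℓ) j → Xhat k ω ℓ = grid k ℓ j)
    (hran : ∀ k ω ℓ, ∃ j, j < N k ℓ ∧ Xhat k ω ℓ = grid k ℓ j)
    -- data of the statement
    (k : ℕ) (hk : k < n) (ℓ : Fin d)
    (xk : ((ℓ' : Fin d) → Fin (N k ℓ')) → Fin d → ℝ)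
    (hxk : ∀ i, xk i = fun ℓ' => grid k ℓ' (i ℓ' : ℕ))
    (hrowpos : ∀ i, 0 < pr {ω | Xhat k ω = xk i} →
      0 < Real.sqrt (∑ p, (σm k (xk i) ℓ p) ^ 2))
    (j : ℕ) (hj : j < N (k + 1) ℓ) :
    pr {ω | Xtil (k + 1) ω ℓ ∈ cell (N (k + 1) ℓ) (grid (k + 1) ℓ) j}
      = ∑ i : (ℓ' : Fin d) → Fin (N k ℓ'),
          (Phi0E (affE (hi (N (k + 1) ℓ) (grid (k + 1) ℓ) j)
              (xk i ℓ + Δ * b k (xk i) ℓ)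
              (Real.sqrt Δ * Real.sqrt (∑ p, (σm k (xk i) ℓ p) ^ 2)))
            - Phi0E (affE (lo (grid (k + 1) ℓ) j)
              (xk i ℓ + Δ * b k (xk i) ℓ)
              (Real.sqrt Δ * Real.sqrt (∑ p, (σm k (xk i) ℓ p) ^ 2))))
          * pr {ω | Xhat k ω = xk i} := by
  have hr : 0 < √Δ := Real.sqrt_pos.2 (hΔ ▸ div_pos hT (Nat.cast_pos.2 hn))
  set C := cell (N (k + 1) ℓ) (grid (k + 1) ℓ) j
  have hXi : ∀ i, MeasurableSet {ω | Xhat k ω = xk i} := fun i =>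
    hXhatmeas k (measurableSet_singleton (xk i))
  have hinj : Function.Injective xk := fun i i' h => by
    funext ℓ'
    refine Fin.ext ((hgrid k ℓ').injOn (i ℓ').2 (i' ℓ').2 ?_)
    simpa [hxk] using congrFun h ℓ'
  have hcover : {ω | Xtil (k + 1) ω ℓ ∈ C} =
      ⋃ i ∈ Finset.univ, {ω | Xhat k ω = xk i} ∩ {ω | Xtil (k + 1) ω ℓ ∈ C} := by
    ext ω
    choose a ha hXa using hran k ω
    simp only [Finset.mem_univ, iUnion_true, mem_iUnion, mem_inter_iff, mem_ofPred_eq,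
      exists_and_right]
    refine ⟨fun h => ⟨⟨fun ℓ' => ⟨a ℓ', ha ℓ'⟩, ?_⟩, h⟩, fun h => h.2⟩
    rw [hxk]
    exact funext hXa
  have hXtil : MeasurableSet {ω | Xtil (k + 1) ω ℓ ∈ C} :=
    ((measurable_pi_apply ℓ).comp (hXtilmeas (k + 1))) (measurableSet_cell _ _ _)
  change (ℙ : Measure Ω).real _ = _
  rw [hcover, measureReal_biUnion_finset]
  · refine Finset.sum_congr rfl fun i _ => ?_
    by_cases hpos : 0 < pr {ω | Xhat k ω = xk i}
    · set m := xk i ℓ + Δ * b k (xk i) ℓ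
      set D := {z : Fin q → ℝ | m + √Δ * ∑ p, σm k (xk i) ℓ p * z p ∈ C}
      have hDmeas : MeasurableSet D := (measurableSet_cell _ _ _).preimage (by fun_prop)
      have hstep : {ω | Xhat k ω = xk i} ∩ {ω | Xtil (k + 1) ω ℓ ∈ C} =
          Xhat k ⁻¹' {xk i} ∩ Z (k + 1) ⁻¹' D := by
        ext ω
        refine and_congr_right fun (h : Xhat k ω = xk i) => ?_
        rw [mem_ofPred_eq, hrec, h]
        rfl
      rw [hstep, measureReal_def, (hindep k).measure_inter_preimage_eq_mul _ _
        (measurableSet_singleton _) hDmeas, ENNReal.toReal_mul, mul_comm,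
        ← gaussPi_affine_cell (hgrid (k + 1) ℓ) hj hr m _ (hrowpos i hpos), ← hZlaw k,
        map_measureReal_apply (hZmeas _) hDmeas]
      rfl
    · have hzero : pr {ω | Xhat k ω = xk i} = 0 :=
        le_antisymm (not_lt.1 hpos) ENNReal.toReal_nonneg
      rw [hzero, mul_zero]
      exact measureReal_mono_null inter_subset_left hzero
  · intro i _ i' _ hne
    refine Set.disjoint_left.2 fun ω h h' => hne (hinj ?_)
    exact h.1.symm.trans h'.1
  · exact fun i _ => (hXi i).inter hXtil
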